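/- arXiv:1301.6540 — 2 statements merged into one kernel-verified Lean document; each statement's English description precedes it below -/
import Mathlib

section
/- Let λ be an integer partition of n with exactly m_s parts equal to s for each s = 1,…,r (so Σ_s s·m_s = n). Then the maximum of cr^ℓ(π) over all set partitions π of [n] whose multiset of block sizes equals λ is M^ℓ(λ) = Σ_{s=2}^{r} (2s−3)·C(m_s,2) + Σ_{1≤s<t≤r} 2·(s−1)·m_s·m_t. -/
open Finset

/-- Two elements lie in the same block of the set partition `π` of `[n]`. -/
def sameBlock {n : ℕ} (π : Finpartition (univ : Finset (Fin n))) (a b : Fin n) : Prop :=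
  ∃ B ∈ π.parts, a ∈ B ∧ b ∈ B

/-- `(a, b)` is an arc of `π`: `a < b`, they lie in a common block, and no element of that
block lies strictly between them. -/
def IsArc {n : ℕ} (π : Finpartition (univ : Finset (Fin n))) (a b : Fin n) : Prop :=
  a < b ∧ sameBlock π a b ∧ ∀ c : Fin n, a < c → c < b → ¬ sameBlock π a c

/-- The linear crossing number `cr^ℓ(π)`: the number of pairs of arcs
`((a,b),(c,d))` with `a < c < b < d`. -/
noncomputable def crl {n : ℕ} (π : Finpartition (univ : Finset (Fin n))) : ℕ :=
  Set.ncard {q : (Fin n × Fin n) × (Fin n × Fin n) |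
    IsArc π q.1.1 q.1.2 ∧ IsArc π q.2.1 q.2.2 ∧
    q.1.1 < q.2.1 ∧ q.2.1 < q.1.2 ∧ q.1.2 < q.2.2}

/-- `(a, b)` is a chord of `π`: `a < b` lie in a common block `B`, and either they are
consecutive elements of `B`, or `B` has at least 3 elements and `a = min B`, `b = max B`. -/
def IsChord {n : ℕ} (π : Finpartition (univ : Finset (Fin n))) (a b : Fin n) : Prop :=
  a < b ∧ ∃ B ∈ π.parts, a ∈ B ∧ b ∈ B ∧
    ((∀ c ∈ B, ¬(a < c ∧ c < b)) ∨ (3 ≤ B.card ∧ ∀ c ∈ B, a ≤ c ∧ c ≤ b))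

/-- The circular crossing number `cr^c(π)`: the number of unordered pairs of crossing chords,
counted as ordered pairs `((a,b),(c,d))` of chords with `a < c < b < d`. -/
noncomputable def crc {n : ℕ} (π : Finpartition (univ : Finset (Fin n))) : ℕ :=
  Set.ncard {q : (Fin n × Fin n) × (Fin n × Fin n) |
    IsChord π q.1.1 q.1.2 ∧ IsChord π q.2.1 q.2.2 ∧
    q.1.1 < q.2.1 ∧ q.2.1 < q.1.2 ∧ q.1.2 < q.2.2}

/-- The Stirling number of the second kind `S(n,k)`: the number of set partitions of `[n]`
into exactly `k` blocks. -/
noncomputable def stirling (n k : ℕ) : ℕ :=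
  Nat.card {π : Finpartition (univ : Finset (Fin n)) // π.parts.card = k}

/-- Stirling numbers with integer arguments: `S(m,j) = 0` unless `0 ≤ j ≤ m`. -/
noncomputable def stirlingZ (m j : ℤ) : ℕ :=
  if 0 ≤ m ∧ 0 ≤ j then stirling m.toNat j.toNat else 0

/-- The Bell number `B_n`: the number of set partitions of `[n]`. -/
noncomputable def bell (n : ℕ) : ℕ :=
  Nat.card (Finpartition (univ : Finset (Fin n)))

/-- The set partitions of `[n]` with exactly `k` blocks, as a `Finset`. -/
def Pik (n k : ℕ) : Finset (Finpartition (univ : Finset (Fin n))) :=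
  Finset.univ.filter fun π => π.parts.card = k

/-- The mean of the linear crossing number over `Π_n^k`. -/
noncomputable def EX (n k : ℕ) : ℝ :=
  (∑ π ∈ Pik n k, (crl π : ℝ)) / stirling n k

/-- The variance of the linear crossing number over `Π_n^k`. -/
noncomputable def VarX (n k : ℕ) : ℝ :=
  (∑ π ∈ Pik n k, (crl π : ℝ) ^ 2) / stirling n k - EX n k ^ 2

/-- The mean of the circular crossing number over `Π_n^k`. -/
noncomputable def EY (n k : ℕ) : ℝ :=
  (∑ π ∈ Pik n k, (crc π : ℝ)) / stirling n k

/-- The variance of the circular crossing number over `Π_n^k`. -/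
noncomputable def VarY (n k : ℕ) : ℝ :=
  (∑ π ∈ Pik n k, (crc π : ℝ) ^ 2) / stirling n k - EY n k ^ 2

/-- The mean of the linear crossing number over all of `Π_n`. -/
noncomputable def EXall (n : ℕ) : ℝ :=
  (∑ π : Finpartition (univ : Finset (Fin n)), (crl π : ℝ)) / bell n

/-- The variance of the linear crossing number over all of `Π_n`. -/
noncomputable def VarXall (n : ℕ) : ℝ :=
  (∑ π : Finpartition (univ : Finset (Fin n)), (crl π : ℝ) ^ 2) / bell n - EXall n ^ 2

/-- The mean of the circular crossing number over all of `Π_n`. -/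
noncomputable def EYall (n : ℕ) : ℝ :=
  (∑ π : Finpartition (univ : Finset (Fin n)), (crc π : ℝ)) / bell n

/-- The variance of the circular crossing number over all of `Π_n`. -/
noncomputable def VarYall (n : ℕ) : ℝ :=
  (∑ π : Finpartition (univ : Finset (Fin n)), (crc π : ℝ) ^ 2) / bell n - EYall n ^ 2

/-- The standard normal distribution function `Φ`. -/
noncomputable def stdNormalCDF (x : ℝ) : ℝ :=
  (Real.sqrt (2 * Real.pi))⁻¹ * ∫ t in Set.Iic x, Real.exp (-t ^ 2 / 2)

/-- The pairs of crossing arcs `((a,b),(c,d))`, `a < c < b < d`, where `(a,b)` joins consecutive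
elements of `A` and `(c,d)` joins consecutive elements of `B`. -/
def crossings {α : Type*} [LinearOrder α] (A B : Finset α) : Finset ((α × α) × (α × α)) :=
  ((A ×ˢ A) ×ˢ (B ×ˢ B)).filter fun q =>
    (∀ x ∈ A, ¬ (q.1.1 < x ∧ x < q.1.2)) ∧ (∀ x ∈ B, ¬ (q.2.1 < x ∧ x < q.2.2)) ∧
    q.1.1 < q.2.1 ∧ q.2.1 < q.1.2 ∧ q.1.2 < q.2.2

/-- The maximal number of crossings between two blocks of sizes `s` and `t`. -/
def pairBound (s t : ℕ) : ℕ := if s = t then 2 * s - 3 else 2 * (min s t - 1)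

lemma mem_crossings {α : Type*} [LinearOrder α] {A B : Finset α} {a b c d : α} :
    ((a, b), (c, d)) ∈ crossings A B ↔ (a ∈ A ∧ b ∈ A) ∧ (c ∈ B ∧ d ∈ B) ∧
      (∀ x ∈ A, ¬ (a < x ∧ x < b)) ∧ (∀ x ∈ B, ¬ (c < x ∧ x < d)) ∧ a < c ∧ c < b ∧ b < d := by
  simp [crossings, and_assoc]

lemma crossings_self {α : Type*} [LinearOrder α] (A : Finset α) : crossings A A = ∅ := by
  ext ⟨⟨a, b⟩, c, d⟩
  rw [mem_crossings]
  simp only [notMem_empty, iff_false]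
  rintro ⟨-, ⟨hc, -⟩, h, -, h1, h2, -⟩
  exact h c hc ⟨h1, h2⟩

lemma crossings_injOn_right {α : Type*} [LinearOrder α] (A B : Finset α) :
    Set.InjOn (fun q : (α × α) × (α × α) => q.1.2) (crossings A B) := by
  rintro ⟨⟨a, b⟩, c, d⟩ h ⟨⟨a', b'⟩, c', d'⟩ h' (rfl : b = b')
  rw [mem_coe, mem_crossings] at h h'
  obtain ⟨⟨ha, hb⟩, ⟨hc, hd⟩, hA, hB, h1, h2, h3⟩ := h
  obtain ⟨⟨ha', hb'⟩, ⟨hc', hd'⟩, hA', hB', h1', h2', h3'⟩ := h'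
  have e1 : a = a' := by grind
  have e2 : c = c' := by grind
  subst e1 e2
  have e3 : d = d' := by grind
  rw [e3]

lemma crossings_injOn_left {α : Type*} [LinearOrder α] (A B : Finset α) :
    Set.InjOn (fun q : (α × α) × (α × α) => q.2.1) (crossings A B) := by
  rintro ⟨⟨a, b⟩, c, d⟩ h ⟨⟨a', b'⟩, c', d'⟩ h' (rfl : c = c')
  rw [mem_coe, mem_crossings] at h h'
  obtain ⟨⟨ha, hb⟩, ⟨hc, hd⟩, hA, hB, h1, h2, h3⟩ := h
  obtain ⟨⟨ha', hb'⟩, ⟨hc', hd'⟩, hA', hB', h1', h2', h3'⟩ := h'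
  have e1 : d = d' := by grind
  have e2 : b = b' := by grind
  subst e1 e2
  have e3 : a = a' := by grind
  rw [e3]

lemma card_crossings_le_left {α : Type*} [LinearOrder α] {A : Finset α} (hA : A.Nonempty)
    (B : Finset α) : (crossings A B).card ≤ A.card - 1 := by
  rw [← card_erase_of_mem (A.min'_mem hA)]
  refine card_le_card_of_injOn _ ?_ (crossings_injOn_right A B)
  rintro ⟨⟨a, b⟩, c, d⟩ h
  rw [mem_coe, mem_crossings] at h
  obtain ⟨⟨ha, hb⟩, -, -, -, h1, h2, -⟩ := h
  rw [mem_coe, mem_erase]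
  exact ⟨((A.min'_le a ha).trans_lt (h1.trans h2)).ne', hb⟩

lemma card_crossings_le_right {α : Type*} [LinearOrder α] (A : Finset α) {B : Finset α}
    (hB : B.Nonempty) : (crossings A B).card ≤ B.card - 1 := by
  rw [← card_erase_of_mem (B.max'_mem hB)]
  refine card_le_card_of_injOn _ ?_ (crossings_injOn_left A B)
  rintro ⟨⟨a, b⟩, c, d⟩ h
  rw [mem_coe, mem_crossings] at h
  obtain ⟨-, ⟨hc, hd⟩, -, -, -, h2, h3⟩ := h
  rw [mem_coe, mem_erase]
  exact ⟨((h2.trans h3).trans_le (B.le_max' d hd)).ne, hc⟩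

lemma card_crossings_le_of_min_lt {α : Type*} [LinearOrder α] {A B : Finset α}
    (hA : A.Nonempty) (hB : B.Nonempty) (hAB : B.min' hB < A.min' hA) :
    (crossings A B).card ≤ B.card - 2 := by
  have hsub : (crossings A B).card ≤ ((B.erase (B.max' hB)).erase (B.min' hB)).card := by
    refine card_le_card_of_injOn _ ?_ (crossings_injOn_left A B)
    rintro ⟨⟨a, b⟩, c, d⟩ h
    rw [mem_coe, mem_crossings] at h
    obtain ⟨⟨ha, -⟩, ⟨hc, hd⟩, -, -, h1, h2, h3⟩ := h
    rw [mem_coe, mem_erase, mem_erase]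
    exact ⟨(hAB.trans_le ((A.min'_le a ha).trans h1.le)).ne',
      ((h2.trans h3).trans_le (B.le_max' d hd)).ne, hc⟩
  have hcard := card_erase_of_mem (B.max'_mem hB)
  rcases lt_or_eq_of_le (Nat.succ_le_of_lt hB.card_pos) with h | h
  · have hne : B.min' hB ≠ B.max' hB := (B.min'_lt_max'_of_card h).ne
    rw [card_erase_of_mem (mem_erase.2 ⟨hne, B.min'_mem hB⟩), hcard] at hsub
    omega
  · have := card_erase_le (s := B.erase (B.max' hB)) (a := B.min' hB)
    omega

lemma card_crossings_add_le {α : Type*} [LinearOrder α] {A B : Finset α}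
    (hA : A.Nonempty) (hB : B.Nonempty) (hAB : Disjoint A B) :
    (crossings A B).card + (crossings B A).card ≤ pairBound A.card B.card := by
  have h1 := card_crossings_le_left hA B
  have h2 := card_crossings_le_left hB A
  have h3 := card_crossings_le_right A hB
  have h4 := card_crossings_le_right B hA
  unfold pairBound
  split_ifs with h
  · have hne : A.min' hA ≠ B.min' hB := fun e =>
      disjoint_left.1 hAB (A.min'_mem hA) (e ▸ B.min'_mem hB)
    rcases hne.lt_or_gt with h' | h'
    · have := card_crossings_le_of_min_lt hB hA h'
      omega
    · have := card_crossings_le_of_min_lt hA hB h'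
      omega
  · omega

lemma isArc_iff {n : ℕ} (π : Finpartition (univ : Finset (Fin n))) (a b : Fin n) :
    IsArc π a b ↔ a < b ∧ b ∈ π.part a ∧ ∀ x ∈ π.part a, ¬ (a < x ∧ x < b) := by
  have key : ∀ x, sameBlock π a x ↔ x ∈ π.part a := by
    intro x
    constructor
    · rintro ⟨B, hB, ha, hx⟩
      rwa [π.part_eq_of_mem hB ha]
    · intro hx
      exact ⟨π.part a, π.part_mem.2 (mem_univ a), π.mem_part (mem_univ a), hx⟩
  simp only [IsArc, key]
  grind

lemma crl_eq_sum {n : ℕ} (π : Finpartition (univ : Finset (Fin n))) :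
    crl π = ∑ A ∈ π.parts, ∑ B ∈ π.parts, (crossings A B).card := by
  classical
  unfold crl
  rw [Set.ncard_eq_toFinset_card', ← sum_product',
    card_eq_sum_card_fiberwise (f := fun q => (π.part q.1.1, π.part q.2.1))
      (t := π.parts ×ˢ π.parts)]
  · refine sum_congr rfl ?_
    rintro ⟨A, B⟩ hAB
    rw [mem_product] at hAB
    congr 1
    ext ⟨⟨a, b⟩, c, d⟩
    rw [mem_crossings]
    simp only [mem_filter, Set.mem_toFinset, Set.mem_ofPred_eq, isArc_iff, Prod.mk.injEq]
    constructor
    · rintro ⟨⟨⟨h1, h2, h3⟩, ⟨h4, h5, h6⟩, h7⟩, rfl, rfl⟩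
      exact ⟨⟨π.mem_part (mem_univ a), h2⟩, ⟨π.mem_part (mem_univ c), h5⟩, h3, h6, h7⟩
    · rintro ⟨⟨h1, h2⟩, ⟨h3, h4⟩, h5, h6, h7, h8, h9⟩
      obtain rfl := π.part_eq_of_mem hAB.1 h1
      obtain rfl := π.part_eq_of_mem hAB.2 h3
      exact ⟨⟨⟨h7.trans h8, h2, h5⟩, ⟨h8.trans h9, h4, h6⟩, h7, h8, h9⟩, rfl, rfl⟩
  · intro q _
    simp

lemma two_mul_crl {n : ℕ} (π : Finpartition (univ : Finset (Fin n))) :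
    2 * crl π = ∑ A ∈ π.parts, ∑ B ∈ π.parts.erase A,
      ((crossings A B).card + (crossings B A).card) := by
  have h : ∀ A ∈ π.parts, ∑ B ∈ π.parts.erase A,
      ((crossings A B).card + (crossings B A).card)
        = ∑ B ∈ π.parts, ((crossings A B).card + (crossings B A).card) := by
    intro A hA
    rw [← add_sum_erase _ _ hA, crossings_self]
    simp
  rw [sum_congr rfl h]
  simp only [sum_add_distrib]
  rw [sum_comm (f := fun A B => (crossings B A).card), ← crl_eq_sum, two_mul]

lemma sum_sum_eq_diag_add_two_mul (F : ℕ → ℕ → ℕ) (hF : ∀ s t, F s t = F t s) (r : ℕ) :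
    ∑ s ∈ Icc 1 r, ∑ t ∈ Icc 1 r, F s t
      = ∑ s ∈ Icc 1 r, F s s + 2 * ∑ s ∈ Icc 1 r, ∑ t ∈ Icc (s + 1) r, F s t := by
  induction r with
  | zero => simp
  | succ r ih =>
    have h : ∑ s ∈ Icc 1 r, ∑ t ∈ Icc (s + 1) (r + 1), F s t
        = ∑ s ∈ Icc 1 r, ∑ t ∈ Icc (s + 1) r, F s t + ∑ s ∈ Icc 1 r, F s (r + 1) := by
      rw [← sum_add_distrib]
      refine sum_congr rfl fun s hs => ?_
      rw [sum_Icc_succ_top (by simp at hs; omega)]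
    have h' : ∑ t ∈ Icc 1 r, F (r + 1) t = ∑ s ∈ Icc 1 r, F s (r + 1) :=
      sum_congr rfl fun s _ => hF _ _
    simp only [sum_Icc_succ_top (show 1 ≤ r + 1 by omega), sum_add_distrib, h, h', ih]
    simp
    ring

lemma sum_blocks {n r : ℕ} {m : ℕ → ℕ} {π : Finpartition (univ : Finset (Fin n))}
    (hπ : Multiset.map Finset.card π.parts.val
      = ∑ s ∈ Icc 1 r, Multiset.replicate (m s) s) (f : ℕ → ℕ) :
    ∑ A ∈ π.parts, f A.card = ∑ s ∈ Icc 1 r, m s * f s := by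
  have h := congrArg (fun M : Multiset ℕ => (M.map f).sum) hπ
  simp only [Multiset.map_map] at h
  change (Multiset.map (fun A => f A.card) π.parts.val).sum = _ at h
  rw [Finset.sum, h, ← Multiset.coe_mapAddMonoidHom, map_sum, ← Multiset.coe_sumAddMonoidHom,
    map_sum]
  simp

lemma sum_pairBound {n r : ℕ} {m : ℕ → ℕ} {π : Finpartition (univ : Finset (Fin n))}
    (hπ : Multiset.map Finset.card π.parts.val
      = ∑ s ∈ Icc 1 r, Multiset.replicate (m s) s) :
    ∑ A ∈ π.parts, ∑ B ∈ π.parts.erase A, pairBound A.card B.card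
      = 2 * ((∑ s ∈ Icc 2 r, (2 * s - 3) * (m s).choose 2)
        + ∑ s ∈ Icc 1 r, ∑ t ∈ Icc (s + 1) r, 2 * (s - 1) * m s * m t) := by
  have h1 : ∑ A ∈ π.parts, ∑ B ∈ π.parts.erase A, pairBound A.card B.card
      + ∑ s ∈ Icc 1 r, m s * pairBound s s
      = ∑ s ∈ Icc 1 r, ∑ t ∈ Icc 1 r, m s * (m t * pairBound s t) := by
    simp only [← mul_sum]
    rw [← sum_blocks hπ (fun s => ∑ t ∈ Icc 1 r, m t * pairBound s t),
      ← sum_blocks hπ (fun s => pairBound s s), ← sum_add_distrib]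
    refine sum_congr rfl fun A hA => ?_
    rw [← sum_blocks hπ (fun t => pairBound A.card t), sum_erase_add _ _ hA]
  rw [sum_sum_eq_diag_add_two_mul (fun s t => m s * (m t * pairBound s t))] at h1
  · have h2 : ∑ s ∈ Icc 1 r, ∑ t ∈ Icc (s + 1) r, m s * (m t * pairBound s t)
        = ∑ s ∈ Icc 1 r, ∑ t ∈ Icc (s + 1) r, 2 * (s - 1) * m s * m t := by
      refine sum_congr rfl fun s _ => sum_congr rfl fun t ht => ?_
      rw [mem_Icc] at ht
      rw [pairBound, if_neg (by omega), min_eq_left (by omega)]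
      ring
    have h3 : ∑ s ∈ Icc 1 r, m s * (m s * pairBound s s)
        = 2 * (∑ s ∈ Icc 2 r, (2 * s - 3) * (m s).choose 2)
          + ∑ s ∈ Icc 1 r, m s * pairBound s s := by
      have h4 : ∑ s ∈ Icc 2 r, (2 * s - 3) * (m s).choose 2
          = ∑ s ∈ Icc 1 r, (2 * s - 3) * (m s).choose 2 := by
        refine sum_subset (Icc_subset_Icc_left (by omega)) fun s hs hs' => ?_
        have : s = 1 := by simp only [mem_Icc] at hs hs'; omega
        simp [this]
      rw [h4, mul_sum, ← sum_add_distrib]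
      refine sum_congr rfl fun s _ => ?_
      have h5 : m s * m s = 2 * (m s).choose 2 + m s := by
        rw [Nat.choose_two_right, Nat.mul_div_cancel' (Nat.even_mul_pred_self _).two_dvd]
        cases m s <;> simp
        ring
      rw [← mul_assoc, h5, pairBound, if_pos rfl]
      ring
    rw [h2, h3] at h1
    omega
  · intro s t
    simp only [pairBound]
    split_ifs with h h' h'
    · subst h; rfl
    · omega
    · omega
    · rw [min_comm]; ring

lemma pairBound_comm (s t : ℕ) : pairBound s t = pairBound t s := by
  unfold pairBound
  split_ifs <;> grind

lemma crl_le {n r : ℕ} {m : ℕ → ℕ} {π : Finpartition (univ : Finset (Fin n))}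
    (hπ : Multiset.map Finset.card π.parts.val
      = ∑ s ∈ Icc 1 r, Multiset.replicate (m s) s) :
    crl π ≤ (∑ s ∈ Icc 2 r, (2 * s - 3) * (m s).choose 2)
      + ∑ s ∈ Icc 1 r, ∑ t ∈ Icc (s + 1) r, 2 * (s - 1) * m s * m t := by
  refine Nat.le_of_mul_le_mul_left (c := 2) ?_ two_pos
  rw [two_mul_crl, ← sum_pairBound hπ]
  refine sum_le_sum fun A hA => sum_le_sum fun B hB => ?_
  rw [mem_erase] at hB
  exact card_crossings_add_le (π.nonempty_of_mem_parts hA) (π.nonempty_of_mem_parts hB.2)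
    (π.disjoint hA hB.2 hB.1.symm)

lemma exists_equiv_fin_lt_iff_lt {α β : Type*} [Fintype α] [LinearOrder β] {key : α → β}
    (hkey : Function.Injective key) {n : ℕ} (hn : Fintype.card α = n) :
    ∃ e : α ≃ Fin n, ∀ x y, e x < e y ↔ key x < key y := by
  let _ : LinearOrder α := LinearOrder.lift' key hkey
  let e := Fintype.orderIsoFinOfCardEq α hn
  exact ⟨e.symm.toEquiv, fun x y => e.symm.lt_iff_lt⟩

/-- The cells of a diagram with row lengths `l` can be numbered column by column. -/
lemma exists_column_numbering {p n : ℕ} (l : Fin p → ℕ) (hl : ∑ i, l i = n) :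
    ∃ e : (Σ i, Fin (l i)) ≃ Fin n, ∀ i j (k : Fin (l i)) (k' : Fin (l j)),
      e ⟨i, k⟩ < e ⟨j, k'⟩ ↔ k.val < k'.val ∨ k.val = k'.val ∧ i < j := by
  let key : (Σ i, Fin (l i)) → ℕ ×ₗ Fin p := fun x => toLex (x.2.val, x.1)
  have hkey : Function.Injective key := by
    rintro ⟨i, k⟩ ⟨j, k'⟩ h
    have h' : (k.val, i) = (k'.val, j) := toLex.injective h
    rw [Prod.mk.injEq] at h'
    obtain ⟨h1, rfl⟩ := h'
    rw [Fin.ext h1]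
  obtain ⟨e, he⟩ := exists_equiv_fin_lt_iff_lt hkey (n := n) (by simp [hl])
  refine ⟨e, fun i j k k' => (he _ _).trans ?_⟩
  exact Prod.Lex.toLex_lt_toLex (x := (k.val, i)) (y := (k'.val, j))

lemma exists_finpartition_of_equiv {p n : ℕ} {l : Fin p → ℕ} (hl : ∀ i, 0 < l i)
    (e : (Σ i, Fin (l i)) ≃ Fin n) :
    ∃ π : Finpartition (univ : Finset (Fin n)),
      π.parts = univ.image (fun i => univ.image fun k => e ⟨i, k⟩) ∧
      Multiset.map Finset.card π.parts.val = Multiset.map l univ.val := by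
  have hmem : ∀ i x, x ∈ univ.image (fun k => e ⟨i, k⟩) ↔ (e.symm x).1 = i := by
    intro i x
    simp only [mem_image, mem_univ, true_and]
    constructor
    · rintro ⟨k, rfl⟩
      simp
    · rintro rfl
      exact ⟨(e.symm x).2, by simp⟩
  have hinj : Function.Injective (fun i => univ.image fun k => e ⟨i, k⟩) := by
    intro i j h
    have h' := (hmem i (e ⟨i, ⟨0, hl i⟩⟩)).2 (by simp)
    rw [show univ.image (fun k => e ⟨i, k⟩) = _ from h, hmem] at h'
    simpa using h'
  refine ⟨Finpartition.ofExistsUnique (univ.image (fun i => univ.image fun k => e ⟨i, k⟩))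
    (fun _ _ => subset_univ _) ?_ ?_, rfl, ?_⟩
  · intro x _
    refine ⟨_, ⟨mem_image_of_mem _ (mem_univ (e.symm x).1), (hmem _ _).2 rfl⟩, ?_⟩
    rintro _ ⟨hB, hx⟩
    obtain ⟨i, -, rfl⟩ := mem_image.1 hB
    rw [hmem] at hx
    rw [hx]
  · intro h
    obtain ⟨i, -, hi⟩ := mem_image.1 h
    have := (hmem i (e ⟨i, ⟨0, hl i⟩⟩)).2 (by simp)
    rw [hi] at this
    exact notMem_empty _ this
  · change Multiset.map Finset.card (univ.image _).val = _
    rw [image_val_of_injOn hinj.injOn, Multiset.map_map]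
    refine Multiset.map_congr rfl fun i _ => ?_
    rw [Function.comp_apply, card_image_of_injective]
    · simp
    · intro k k' h
      simpa using h

lemma pairBound_le_card_crossings {p n : ℕ} {l : Fin p → ℕ} (e : (Σ i, Fin (l i)) ≃ Fin n)
    (he : ∀ i j (k : Fin (l i)) (k' : Fin (l j)),
      e ⟨i, k⟩ < e ⟨j, k'⟩ ↔ k.val < k'.val ∨ k.val = k'.val ∧ i < j)
    {i j : Fin p} (hij : i < j) (hl : l j ≤ l i) :
    pairBound (l i) (l j) ≤
      (crossings (univ.image fun k => e ⟨i, k⟩) (univ.image fun k => e ⟨j, k⟩)).card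
      + (crossings (univ.image fun k => e ⟨j, k⟩) (univ.image fun k => e ⟨i, k⟩)).card := by
  have h1 : l j - 1 ≤
      (crossings (univ.image fun k => e ⟨i, k⟩) (univ.image fun k => e ⟨j, k⟩)).card := by
    rw [← Fintype.card_fin (l j - 1), ← card_univ]
    refine card_le_card_of_injOn (fun k : Fin (l j - 1) =>
      ((e ⟨i, ⟨k, by omega⟩⟩, e ⟨i, ⟨k + 1, by omega⟩⟩),
        (e ⟨j, ⟨k, by omega⟩⟩, e ⟨j, ⟨k + 1, by omega⟩⟩))) ?_ ?_
    · intro k _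
      rw [mem_coe, mem_crossings]
      simp only [mem_image, mem_univ, true_and, forall_exists_index, forall_apply_eq_imp_iff, he,
        exists_apply_eq_apply]
      grind
    · intro k _ k' _ h
      simp only [Prod.mk.injEq, e.apply_eq_iff_eq, Sigma.mk.injEq, heq_eq_eq, Fin.mk.injEq,
        true_and] at h
      exact Fin.ext h.1.1
  have h2 : min (l j - 1) (l i - 2) ≤
      (crossings (univ.image fun k => e ⟨j, k⟩) (univ.image fun k => e ⟨i, k⟩)).card := by
    rw [← Fintype.card_fin (min (l j - 1) (l i - 2)), ← card_univ]
    refine card_le_card_of_injOn (fun k : Fin (min (l j - 1) (l i - 2)) =>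
      ((e ⟨j, ⟨k, by omega⟩⟩, e ⟨j, ⟨k + 1, by omega⟩⟩),
        (e ⟨i, ⟨k + 1, by omega⟩⟩, e ⟨i, ⟨k + 2, by omega⟩⟩))) ?_ ?_
    · intro k _
      rw [mem_coe, mem_crossings]
      simp only [mem_image, mem_univ, true_and, forall_exists_index, forall_apply_eq_imp_iff, he,
        exists_apply_eq_apply]
      grind
    · intro k _ k' _ h
      simp only [Prod.mk.injEq, e.apply_eq_iff_eq, Sigma.mk.injEq, heq_eq_eq, Fin.mk.injEq,
        true_and] at h
      exact Fin.ext h.1.1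
  unfold pairBound
  split_ifs <;> omega

lemma exists_le_crl {n r : ℕ} {m : ℕ → ℕ} (hn : n = ∑ s ∈ Icc 1 r, s * m s) :
    ∃ π : Finpartition (univ : Finset (Fin n)),
      Multiset.map Finset.card π.parts.val = ∑ s ∈ Icc 1 r, Multiset.replicate (m s) s ∧
      (∑ s ∈ Icc 2 r, (2 * s - 3) * (m s).choose 2)
        + ∑ s ∈ Icc 1 r, ∑ t ∈ Icc (s + 1) r, 2 * (s - 1) * m s * m t ≤ crl π := by
  set M := ∑ s ∈ Icc 1 r, Multiset.replicate (m s) s with hM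
  set L := M.sort (· ≥ ·) with hL
  have hmap : Multiset.map L.get univ.val = M := by
    rw [Fin.univ_val_map, List.ofFn_get, hL, Multiset.sort_eq]
  have hpos : ∀ i, 0 < L.get i := by
    intro i
    have h : L.get i ∈ M := (Multiset.mem_sort (r := (· ≥ ·))).1 (List.get_mem L i)
    obtain ⟨s, hs, h⟩ := Multiset.mem_sum.1 h
    rw [Multiset.eq_of_mem_replicate h]
    exact (mem_Icc.1 hs).1
  have hsum : ∑ i, L.get i = n := by
    rw [Finset.sum, hmap, hn, hM, ← Multiset.coe_sumAddMonoidHom, map_sum]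
    simp [mul_comm]
  obtain ⟨e, he⟩ := exists_column_numbering L.get hsum
  obtain ⟨π, hparts, hcard⟩ := exists_finpartition_of_equiv hpos e
  have hπ := hcard.trans hmap
  have hanti : ∀ i j, i < j → L.get j ≤ L.get i := fun i j hij =>
    List.pairwise_iff_get.1 (Multiset.pairwise_sort M (· ≥ ·)) i j hij
  have hblock : ∀ i, (univ.image fun k => e ⟨i, k⟩).card = L.get i := by
    intro i
    rw [card_image_of_injective]
    · simp
    · intro k k' h
      simpa using h
  refine ⟨π, hπ, Nat.le_of_mul_le_mul_left (c := 2) ?_ two_pos⟩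
  rw [two_mul_crl, ← sum_pairBound hπ]
  refine sum_le_sum fun A hA => sum_le_sum fun B hB => ?_
  rw [mem_erase] at hB
  rw [hparts] at hA hB
  obtain ⟨i, -, rfl⟩ := mem_image.1 hA
  obtain ⟨hne, hB⟩ := hB
  obtain ⟨j, -, rfl⟩ := mem_image.1 hB
  rw [hblock, hblock]
  rcases lt_trichotomy i j with h | rfl | h
  · exact pairBound_le_card_crossings e he h (hanti i j h)
  · exact absurd rfl hne
  · rw [pairBound_comm, add_comm]
    exact pairBound_le_card_crossings e he h (hanti j i h)

/-- The maximum of the linear crossing number over set partitions of `[n]` whose block-size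
partition is `λ = (1^{m 1} 2^{m 2} ⋯ r^{m r})`. -/
theorem max_crl_blocksizes (n r : ℕ) (m : ℕ → ℕ)
    (hm : ∀ s : ℕ, s = 0 ∨ r < s → m s = 0)
    (hn : n = ∑ s ∈ Finset.Icc 1 r, s * m s) :
    IsGreatest {c : ℕ | ∃ π : Finpartition (univ : Finset (Fin n)),
        Multiset.map Finset.card π.parts.val
          = ∑ s ∈ Finset.Icc 1 r, Multiset.replicate (m s) s ∧
        crl π = c}
      ((∑ s ∈ Finset.Icc 2 r, (2 * s - 3) * (m s).choose 2)
        + ∑ s ∈ Finset.Icc 1 r, ∑ t ∈ Finset.Icc (s + 1) r,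
            2 * (s - 1) * m s * m t) := by
  constructor
  · obtain ⟨π, hπ, h⟩ := exists_le_crl hn
    exact ⟨π, hπ, (crl_le hπ).antisymm h⟩
  · rintro _ ⟨π, hπ, rfl⟩
    exact crl_le hπ
end

section
/- Let λ be an integer partition of n with exactly m_s parts equal to s for each s = 1,…,r (so Σ_s s·m_s = n). Then the maximum of cr^c(π) over all set partitions π of [n] whose multiset of block sizes equals λ is M^c(λ) = C(m_2,2) + Σ_{s=3}^{r} 2s·C(m_s,2) + 2·m_2·Σ_{t=3}^{r} m_t + Σ_{3≤s<t≤r} 2s·m_s·m_t. -/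
open Finset

/-- The chords of a block `B`: pairs of consecutive elements, together with the pair of extreme
elements when `B` has at least 3 elements. -/
def blockChords {α : Type*} [LinearOrder α] (B : Finset α) : Finset (α × α) :=
  {p ∈ B ×ˢ B | p.1 < p.2 ∧
    ((∀ c ∈ B, ¬(p.1 < c ∧ c < p.2)) ∨ (3 ≤ #B ∧ ∀ c ∈ B, p.1 ≤ c ∧ c ≤ p.2))}

/-- The chords `p` and `q` cross. -/
def Crosses {α : Type*} [LinearOrder α] (p q : α × α) : Prop :=
  (p.1 < q.1 ∧ q.1 < p.2 ∧ p.2 < q.2) ∨ (q.1 < p.1 ∧ p.1 < q.2 ∧ q.2 < p.2)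

instance {α : Type*} [LinearOrder α] (p : α × α) : DecidablePred (Crosses p) :=
  fun _ => inferInstanceAs (Decidable (_ ∨ _))

/-- The number of crossings between the chords of `B` and the chords of `C`. -/
def blockCrossings {α : Type*} [LinearOrder α] (B C : Finset α) : ℕ :=
  ∑ p ∈ blockChords B, #{q ∈ blockChords C | Crosses p q}

/-- The number of chords of a block with `s` elements. -/
def chordCount (s : ℕ) : ℕ := if s ≤ 1 then 0 else if s = 2 then 1 else s

/-- The maximal number of crossings between the chords of two blocks with `s` and `t` elements. -/
def maxCrossings (s t : ℕ) : ℕ :=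
  if s = 2 ∧ t = 2 then 1 else 2 * min (chordCount s) (chordCount t)

section Blocks

variable {α : Type*} [LinearOrder α]

theorem mem_blockChords {B : Finset α} {a b : α} :
    (a, b) ∈ blockChords B ↔ (a ∈ B ∧ b ∈ B) ∧ a < b ∧
      ((∀ c ∈ B, ¬(a < c ∧ c < b)) ∨ (3 ≤ #B ∧ ∀ c ∈ B, a ≤ c ∧ c ≤ b)) := by
  simp [blockChords]

theorem crosses_comm (p q : α × α) : Crosses p q ↔ Crosses q p := or_comm

theorem exists_mem_ne_ne {B : Finset α} (h3 : 3 ≤ #B) (u v : α) : ∃ z ∈ B, z ≠ u ∧ z ≠ v := by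
  by_contra! h
  have hsub : B ⊆ {u, v} := fun z hz => by
    simp only [mem_insert, mem_singleton]
    exact or_iff_not_imp_left.2 (h z hz)
  have := (card_le_card hsub).trans card_le_two
  omega

theorem exists_consecutive {B : Finset α} {a x : α} (hx : x ∈ B) (hax : a < x) :
    ∃ d ∈ B, a < d ∧ ∀ c ∈ B, ¬(a < c ∧ c < d) := by
  have hne : (B.filter (a < ·)).Nonempty := ⟨x, by simp [hx, hax]⟩
  have h := Finset.min'_mem _ hne
  simp only [mem_filter] at h
  refine ⟨_, h.1, h.2, fun c hc ⟨h1, h2⟩ => ?_⟩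
  exact absurd (Finset.min'_le _ c (by simp [hc, h1])) (not_le.2 h2)

theorem exists_consecutive_around {B : Finset α} {a x y : α} (hx : x ∈ B) (hxa : x < a)
    (hy : y ∈ B) (hay : a < y) (ha : a ∉ B) :
    ∃ c ∈ B, ∃ d ∈ B, c < a ∧ a < d ∧ ∀ z ∈ B, ¬(c < z ∧ z < d) := by
  have hne : (B.filter (· < a)).Nonempty := ⟨x, by simp [hx, hxa]⟩
  have h := Finset.max'_mem _ hne
  simp only [mem_filter] at h
  obtain ⟨d, hd, had, h2⟩ := exists_consecutive hy hay
  refine ⟨_, h.1, d, hd, h.2, had, fun z hz ⟨h3, h4⟩ => ?_⟩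
  rcases lt_trichotomy z a with h5 | h5 | h5
  · exact absurd (Finset.le_max' _ z (by simp [hz, h5])) (not_le.2 h3)
  · exact ha (h5 ▸ hz)
  · exact h2 z hz ⟨h5, h4⟩

theorem card_consecutive (B : Finset α) :
    #{p ∈ B ×ˢ B | p.1 < p.2 ∧ ∀ c ∈ B, ¬(p.1 < c ∧ c < p.2)} = #B - 1 := by
  rcases B.eq_empty_or_nonempty with rfl | hB
  · simp
  rw [← Finset.card_erase_of_mem (B.max'_mem hB)]
  refine Finset.card_bij (fun p _ => p.1) ?_ ?_ ?_
  · rintro ⟨a, b⟩ h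
    simp only [mem_filter, mem_product, mem_erase] at h ⊢
    exact ⟨(h.2.1.trans_le (B.le_max' b h.1.2)).ne, h.1.1⟩
  · rintro ⟨a, b⟩ h ⟨a', b'⟩ h' (rfl : a = a')
    simp only [mem_filter, mem_product] at h h'
    have h1 := h.2.2 b' h'.1.2
    have h2 := h'.2.2 b h.1.2
    simp only [Prod.mk.injEq, true_and]
    grind
  · intro a ha
    simp only [mem_erase] at ha
    obtain ⟨d, hd, had, h⟩ := exists_consecutive (B.max'_mem hB)
      (lt_of_le_of_ne (B.le_max' a ha.2) ha.1)
    exact ⟨(a, d), by simp only [mem_filter, mem_product]; exact ⟨⟨ha.2, hd⟩, had, h⟩, rfl⟩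

theorem card_blockChords (B : Finset α) : #(blockChords B) = chordCount #B := by
  by_cases h3 : 3 ≤ #B
  · have hB : B.Nonempty := by rw [← Finset.card_pos]; omega
    have hmin := B.min'_mem hB
    have hmax := B.max'_mem hB
    obtain ⟨z, hz, hz1, hz2⟩ := exists_mem_ne_ne h3 (B.min' hB) (B.max' hB)
    have h1 : B.min' hB < z := lt_of_le_of_ne (B.min'_le z hz) hz1.symm
    have h2 : z < B.max' hB := lt_of_le_of_ne (B.le_max' z hz) hz2
    have key : blockChords B = insert (B.min' hB, B.max' hB)
        {p ∈ B ×ˢ B | p.1 < p.2 ∧ ∀ c ∈ B, ¬(p.1 < c ∧ c < p.2)} := by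
      ext ⟨a, b⟩
      simp only [mem_blockChords, mem_insert, mem_filter, mem_product, Prod.mk.injEq]
      constructor
      · rintro ⟨hab, hlt, h | h⟩
        · exact Or.inr ⟨hab, hlt, h⟩
        · exact Or.inl ⟨le_antisymm (h.2 _ hmin).1 (B.min'_le a hab.1),
            le_antisymm (B.le_max' b hab.2) (h.2 _ hmax).2⟩
      · rintro (⟨rfl, rfl⟩ | ⟨hab, hlt, h⟩)
        · exact ⟨⟨hmin, hmax⟩, h1.trans h2, Or.inr ⟨h3, fun c hc =>
            ⟨B.min'_le c hc, B.le_max' c hc⟩⟩⟩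
        · exact ⟨hab, hlt, Or.inl h⟩
    rw [key, Finset.card_insert_of_notMem, card_consecutive]
    · unfold chordCount
      split_ifs <;> omega
    · simp only [mem_filter, not_and]
      exact fun _ _ h => h z hz h1 h2
  · have key : blockChords B = {p ∈ B ×ˢ B | p.1 < p.2 ∧ ∀ c ∈ B, ¬(p.1 < c ∧ c < p.2)} := by
      simp only [blockChords, h3, false_and, or_false]
    rw [key, card_consecutive]
    unfold chordCount
    split_ifs <;> omega

theorem card_crossing_le_two (C : Finset α) {a b : α} :
    #{q ∈ blockChords C | Crosses (a, b) q} ≤ 2 := by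
  classical
  let S : Finset (α × α) := {q ∈ blockChords C | Crosses (a, b) q}
  let P : α × α → Prop := fun q => ∀ c ∈ C, ¬(q.1 < c ∧ c < q.2)
  have hsub : S ⊆ S.filter (fun q => P q ∧ q.1 < a ∨ ¬ P q ∧ a < q.1) ∪
      S.filter (fun q => P q ∧ b < q.2 ∨ ¬ P q ∧ q.2 < b) := by
    intro q hq
    have hc : Crosses (a, b) q := (mem_filter.1 hq).2
    simp only [mem_union, mem_filter, hq, true_and]
    simp only [Crosses] at hc
    by_cases hP : P q <;> simp only [hP] <;> grind
  have hmem : ∀ q ∈ S, (q.1 ∈ C ∧ q.2 ∈ C) ∧ q.1 < q.2 ∧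
      (P q ∨ ∀ c ∈ C, q.1 ≤ c ∧ c ≤ q.2) ∧ Crosses (a, b) q := by
    rintro ⟨c, d⟩ hq
    have h := mem_filter.1 hq
    have h' := mem_blockChords.1 h.1
    exact ⟨h'.1, h'.2.1, h'.2.2.imp id And.right, h.2⟩
  refine (card_le_card hsub).trans ((card_union_le _ _).trans (Nat.add_le_add (?_ : _ ≤ 1) (?_ : _ ≤ 1))) <;>
  · refine card_le_one.2 fun q hq q' hq' => ?_
    obtain ⟨hq, hs⟩ := mem_filter.1 hq
    obtain ⟨hq', hs'⟩ := mem_filter.1 hq'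
    obtain ⟨⟨h1, h2⟩, h3, h4, h5⟩ := hmem q hq
    obtain ⟨⟨h1', h2'⟩, h3', h4', h5'⟩ := hmem q' hq'
    obtain ⟨c, d⟩ := q
    obtain ⟨c', d'⟩ := q'
    simp only [Crosses, P] at *
    have e1 := fun h : (∀ x ∈ C, ¬(c < x ∧ x < d)) => h c' h1'
    have e2 := fun h : (∀ x ∈ C, ¬(c < x ∧ x < d)) => h d' h2'
    have e3 := fun h : (∀ x ∈ C, ¬(c' < x ∧ x < d')) => h c h1
    have e4 := fun h : (∀ x ∈ C, ¬(c' < x ∧ x < d')) => h d h2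
    have e5 := fun h : (∀ x ∈ C, c ≤ x ∧ x ≤ d) => h c' h1'
    have e6 := fun h : (∀ x ∈ C, c ≤ x ∧ x ≤ d) => h d' h2'
    have e7 := fun h : (∀ x ∈ C, c' ≤ x ∧ x ≤ d') => h c h1
    have e8 := fun h : (∀ x ∈ C, c' ≤ x ∧ x ≤ d') => h d h2
    generalize (∀ x ∈ C, ¬(c < x ∧ x < d)) = P1 at *
    generalize (∀ x ∈ C, ¬(c' < x ∧ x < d')) = P2 at *
    generalize (∀ x ∈ C, c ≤ x ∧ x ≤ d) = P3 at *
    generalize (∀ x ∈ C, c' ≤ x ∧ x ≤ d') = P4 at *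
    clear hsub hmem hq hq'
    have : c = c' ∧ d = d' := by
      by_cases hP1 : P1 <;> by_cases hP2 : P2 <;> simp only [hP1, hP2] at * <;> grind
    simpa using this

/-- A pair `(a, b)` separated by `C` is crossed by a chord of `C`. -/
theorem exists_crossing {C : Finset α} {a b x y : α} (ha : a ∉ C) (hb : b ∉ C)
    (hx : x ∈ C) (hax : a < x) (hxb : x < b) (hy : y ∈ C) (hya : y < a ∨ b < y) :
    ∃ q ∈ blockChords C, Crosses (a, b) q := by
  rcases hya with hya | hby
  · obtain ⟨c, hc, d, hd, hca, had, h⟩ := exists_consecutive_around hy hya hx hax ha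
    have := h x hx
    have hdb : d < b := by grind
    exact ⟨(c, d), mem_blockChords.2 ⟨⟨hc, hd⟩, hca.trans had, Or.inl h⟩, Or.inr ⟨hca, had, hdb⟩⟩
  · obtain ⟨c, hc, d, hd, hcb, hbd, h⟩ := exists_consecutive_around hx hxb hy hby hb
    have := h x hx
    have hac : a < c := by grind
    exact ⟨(c, d), mem_blockChords.2 ⟨⟨hc, hd⟩, hcb.trans hbd, Or.inl h⟩, Or.inl ⟨hac, hcb, hbd⟩⟩

theorem two_le_card_crossing {C : Finset α} (h3 : 3 ≤ #C) {a b x y : α} (ha : a ∉ C)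
    (hb : b ∉ C) (hx : x ∈ C) (hax : a < x) (hxb : x < b) (hy : y ∈ C) (hya : y < a ∨ b < y) :
    2 ≤ #{q ∈ blockChords C | Crosses (a, b) q} := by
  suffices ∃ q ∈ blockChords C, Crosses (a, b) q ∧ ∃ q' ∈ blockChords C,
      Crosses (a, b) q' ∧ q ≠ q' by
    obtain ⟨q, hq, hc, q', hq', hc', hne⟩ := this
    exact Finset.one_lt_card.2 ⟨q, mem_filter.2 ⟨hq, hc⟩, q', mem_filter.2 ⟨hq', hc'⟩, hne⟩
  have hC : C.Nonempty := ⟨x, hx⟩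
  have hmin := C.min'_mem hC
  have hmax := C.max'_mem hC
  have hle : ∀ c ∈ C, C.min' hC ≤ c ∧ c ≤ C.max' hC := fun c hc => ⟨C.min'_le c hc, C.le_max' c hc⟩
  generalize C.min' hC = u at hmin hle
  generalize C.max' hC = v at hmax hle
  have huv (huv : u < v) : (u, v) ∈ blockChords C :=
    mem_blockChords.2 ⟨⟨hmin, hmax⟩, huv, Or.inr ⟨h3, hle⟩⟩
  have hxu := hle x hx
  have hyu := hle y hy
  have hau : a ≠ u := fun h => ha (h ▸ hmin)
  have hbv : b ≠ v := fun h => hb (h ▸ hmax)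
  have around (z w w' : α) (hz : z ∉ C) (hw : w ∈ C) (hwz : w < z) (hw' : w' ∈ C)
      (hzw : z < w') : ∃ c d, (c, d) ∈ blockChords C ∧ c < z ∧ z < d ∧
        (∀ t ∈ C, t < z → t ≤ c) ∧ (∀ t ∈ C, z < t → d ≤ t) := by
    obtain ⟨c, hc, d, hd, hcz, hzd, h⟩ := exists_consecutive_around hw hwz hw' hzw hz
    refine ⟨c, d, mem_blockChords.2 ⟨⟨hc, hd⟩, hcz.trans hzd, Or.inl h⟩, hcz, hzd, ?_, ?_⟩
    · exact fun t ht htz => not_lt.1 fun h' => h t ht ⟨h', htz.trans hzd⟩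
    · exact fun t ht htz => not_lt.1 fun h' => h t ht ⟨hcz.trans htz, h'⟩
  obtain ⟨z, hz, hzu, hzv⟩ := exists_mem_ne_ne h3 u v
  have hza : z ≠ a := fun h => ha (h ▸ hz)
  have hzb : z ≠ b := fun h => hb (h ▸ hz)
  have hzl := hle z hz
  rcases lt_or_gt_of_ne hau with hau | hua
  · -- all elements lie above `a`
    have hbv' : b < v := by grind
    obtain ⟨c, d, hcd, h1, h2, h4, h5⟩ := around b x v hb hx hxb hmax hbv'
    have := h4 x hx hxb
    refine ⟨(u, v), huv (by grind), Or.inl ⟨hau, by grind, hbv'⟩, (c, d), hcd,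
      Or.inl ⟨by grind, h1, h2⟩, ?_⟩
    intro h
    obtain ⟨rfl, rfl⟩ := Prod.mk.inj h
    rcases lt_or_gt_of_ne hzb with h | h
    · exact hzu (le_antisymm (h4 z hz h) hzl.1)
    · exact hzv (le_antisymm hzl.2 (h5 z hz h))
  · obtain ⟨c, d, hcd, h1, h2, h4, h5⟩ := around a u x ha hmin hua hx hax
    have := h5 x hx hax
    refine ⟨(c, d), hcd, Or.inr ⟨h1, h2, by grind⟩, ?_⟩
    rcases lt_or_gt_of_ne hbv with hbv | hvb
    · obtain ⟨c', d', hcd', h1', h2', h4', h5'⟩ := around b x v hb hx hxb hmax hbv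
      have := h4' x hx hxb
      refine ⟨(c', d'), hcd', Or.inl ⟨by grind, h1', h2'⟩, ?_⟩
      clear around huv hle
      simp only [ne_eq, Prod.mk.injEq, not_and]
      grind
    · refine ⟨(u, v), huv (by grind), Or.inr ⟨hua, by grind, hvb⟩, ?_⟩
      intro h
      obtain ⟨rfl, rfl⟩ := Prod.mk.inj h
      rcases lt_or_gt_of_ne hza with h | h
      · exact hzu (le_antisymm (h4 z hz h) hzl.1)
      · exact hzv (le_antisymm hzl.2 (h5 z hz h))

theorem blockCrossings_comm (B C : Finset α) : blockCrossings B C = blockCrossings C B := by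
  simp only [blockCrossings, card_filter]
  rw [sum_comm]
  simp only [crosses_comm]

theorem blockCrossings_self (B : Finset α) : blockCrossings B B = 0 := by
  refine sum_eq_zero fun p hp => ?_
  rw [card_eq_zero, filter_eq_empty_iff]
  intro q hq
  obtain ⟨a, b⟩ := p
  obtain ⟨c, d⟩ := q
  obtain ⟨⟨h1, h2⟩, h3, h4⟩ := mem_blockChords.1 hp
  obtain ⟨⟨h1', h2'⟩, h3', h4'⟩ := mem_blockChords.1 hq
  simp only [Crosses]
  rintro (h | h)
  · rcases h4 with h4 | h4
    · exact h4 c h1' ⟨h.1, h.2.1⟩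
    · exact absurd h.2.2 (not_lt.2 (h4.2 d h2').2)
  · rcases h4' with h4' | h4'
    · exact h4' a h1 ⟨h.1, h.2.1⟩
    · exact absurd h.2.2 (not_lt.2 (h4'.2 b h2).2)

theorem blockCrossings_le_two_mul (B C : Finset α) :
    blockCrossings B C ≤ 2 * chordCount #B := by
  rw [← card_blockChords, mul_comm, ← smul_eq_mul]
  exact sum_le_card_nsmul _ _ _ fun p _ => card_crossing_le_two C

theorem blockCrossings_le (B C : Finset α) : blockCrossings B C ≤ maxCrossings #B #C := by
  unfold maxCrossings
  split_ifs with h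
  · have hB := card_blockChords B
    have hC := card_blockChords C
    rw [h.1] at hB
    rw [h.2] at hC
    calc blockCrossings B C ≤ #(blockChords B) • 1 :=
          sum_le_card_nsmul _ _ _ fun p _ => (card_filter_le _ _).trans hC.le
      _ = 1 := by rw [hB]; rfl
  · have h1 := blockCrossings_le_two_mul B C
    have h2 := blockCrossings_le_two_mul C B
    rw [blockCrossings_comm] at h2
    omega

theorem chordCount_mono : Monotone chordCount := by
  intro s t h
  unfold chordCount
  split_ifs <;> omega

/-- Every pair of elements of `B` is separated by `C`. -/
def Separates (C B : Finset α) : Prop :=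
  ∀ a ∈ B, ∀ b ∈ B, a < b → (∃ x ∈ C, a < x ∧ x < b) ∧ ∃ y ∈ C, y < a ∨ b < y

theorem maxCrossings_le_of_separates {B C : Finset α} (hd : Disjoint B C) (hle : #B ≤ #C)
    (h : Separates C B) : maxCrossings #B #C ≤ blockCrossings B C := by
  have hmin : min (chordCount #B) (chordCount #C) = chordCount #B :=
    min_eq_left (chordCount_mono hle)
  have hsep : ∀ p ∈ blockChords B, ∃ x ∈ C, ∃ y ∈ C, p.1 ∉ C ∧ p.2 ∉ C ∧ p.1 < x ∧ x < p.2 ∧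
      (y < p.1 ∨ p.2 < y) := by
    rintro ⟨a, b⟩ hp
    obtain ⟨⟨h1, h2⟩, h3, -⟩ := mem_blockChords.1 hp
    obtain ⟨⟨x, hx, hx'⟩, y, hy, hy'⟩ := h a h1 b h2 h3
    exact ⟨x, hx, y, hy, disjoint_left.1 hd h1, disjoint_left.1 hd h2, hx'.1, hx'.2, hy'⟩
  have hcard := card_blockChords B
  unfold maxCrossings
  rw [hmin, ← hcard]
  by_cases h3 : 3 ≤ #C
  · rw [if_neg (by omega), mul_comm, ← smul_eq_mul]
    refine card_nsmul_le_sum _ _ _ fun p hp => ?_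
    obtain ⟨x, hx, y, hy, ha, hb, h1, h2, h4⟩ := hsep p hp
    exact two_le_card_crossing h3 ha hb hx h1 h2 hy h4
  · split_ifs with h2
    · calc 1 = #(blockChords B) • 1 := by rw [hcard, h2.1]; rfl
        _ ≤ _ := card_nsmul_le_sum _ _ _ fun p hp => ?_
      obtain ⟨x, hx, y, hy, ha, hb, h1, h2, h4⟩ := hsep p hp
      obtain ⟨q, hq, hc⟩ := exists_crossing ha hb hx h1 h2 hy h4
      exact card_pos.2 ⟨q, mem_filter.2 ⟨hq, hc⟩⟩
    · have : #B ≤ 1 := by omega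
      rw [hcard, chordCount, if_pos this]
      simp

end Blocks

theorem isChord_iff {n : ℕ} (π : Finpartition (univ : Finset (Fin n))) (p : Fin n × Fin n) :
    IsChord π p.1 p.2 ↔ p ∈ π.parts.biUnion blockChords := by
  obtain ⟨a, b⟩ := p
  simp only [IsChord, mem_biUnion, mem_blockChords]
  grind

theorem two_mul_crc {n : ℕ} (π : Finpartition (univ : Finset (Fin n))) :
    2 * crc π = ∑ B ∈ π.parts, ∑ C ∈ π.parts, blockCrossings B C := by
  let K := π.parts.biUnion blockChords
  let f : (Fin n × Fin n) → (Fin n × Fin n) → ℕ := fun p q =>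
    if p.1 < q.1 ∧ q.1 < p.2 ∧ p.2 < q.2 then 1 else 0
  have hdisj : Set.PairwiseDisjoint (π.parts : Set (Finset (Fin n))) blockChords := by
    intro B hB C hC hne
    refine disjoint_left.2 fun ⟨a, b⟩ h h' => ?_
    exact disjoint_left.1 (π.disjoint hB hC hne) (mem_blockChords.1 h).1.1
      (mem_blockChords.1 h').1.1
  have hcrc : crc π = ∑ p ∈ K, ∑ q ∈ K, f p q := by
    rw [← sum_product', ← card_filter, crc, ← Set.ncard_coe_finset]
    congr 1
    ext ⟨p, q⟩
    simp only [isChord_iff, Set.mem_ofPred_eq, coe_filter, mem_product, K, and_assoc]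
  have hsymm : 2 * crc π = ∑ p ∈ K, ∑ q ∈ K, if Crosses p q then 1 else 0 := by
    rw [two_mul, hcrc]
    conv_lhs => enter [2]; rw [sum_comm]
    simp only [← sum_add_distrib]
    refine sum_congr rfl fun p _ => sum_congr rfl fun q _ => ?_
    simp only [f, Crosses]
    grind
  rw [hsymm, sum_biUnion hdisj]
  refine sum_congr rfl fun B _ => ?_
  simp only [blockCrossings, card_filter]
  rw [sum_comm]
  refine (sum_biUnion hdisj).trans (sum_congr rfl fun C _ => sum_comm)

theorem two_mul_crc_add_le {n : ℕ} (π : Finpartition (univ : Finset (Fin n))) :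
    2 * crc π + ∑ B ∈ π.parts, maxCrossings #B #B
      ≤ ∑ B ∈ π.parts, ∑ C ∈ π.parts, maxCrossings #B #C := by
  rw [two_mul_crc, ← sum_add_distrib]
  refine sum_le_sum fun B hB => ?_
  rw [← add_sum_erase _ _ hB, ← add_sum_erase _ (fun C => maxCrossings #B #C) hB,
    blockCrossings_self, zero_add, add_comm]
  exact Nat.add_le_add_left (sum_le_sum fun C _ => blockCrossings_le B C) _

theorem le_two_mul_crc_add {n : ℕ} (π : Finpartition (univ : Finset (Fin n)))
    (h : ∀ B ∈ π.parts, ∀ C ∈ π.parts, B ≠ C → #B ≤ #C → Separates C B) :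
    ∑ B ∈ π.parts, ∑ C ∈ π.parts, maxCrossings #B #C
      ≤ 2 * crc π + ∑ B ∈ π.parts, maxCrossings #B #B := by
  have hcomm (s t : ℕ) : maxCrossings s t = maxCrossings t s := by
    simp only [maxCrossings, min_comm, and_comm]
  rw [two_mul_crc, ← sum_add_distrib]
  refine sum_le_sum fun B hB => ?_
  rw [← add_sum_erase _ _ hB, ← add_sum_erase _ (fun C => blockCrossings B C) hB,
    blockCrossings_self, zero_add, add_comm]
  refine Nat.add_le_add_right (sum_le_sum fun C hC => ?_) _
  obtain ⟨hne, hC⟩ := mem_erase.1 hC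
  have hd := π.disjoint hB hC hne.symm
  rcases le_total #B #C with hle | hle
  · exact maxCrossings_le_of_separates hd hle (h B hB C hC hne.symm hle)
  · rw [hcomm, blockCrossings_comm]
    exact maxCrossings_le_of_separates hd.symm hle (h C hC B hB hne hle)

theorem sum_parts_card {n r : ℕ} {m : ℕ → ℕ} (π : Finpartition (univ : Finset (Fin n)))
    (h : Multiset.map Finset.card π.parts.val = ∑ s ∈ Icc 1 r, Multiset.replicate (m s) s)
    (g : ℕ → ℕ) : ∑ B ∈ π.parts, g #B = ∑ s ∈ Icc 1 r, m s * g s := by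
  have h1 : ∑ B ∈ π.parts, g #B = ((Multiset.map Finset.card π.parts.val).map g).sum := by
    rw [Multiset.map_map]; rfl
  rw [h1, h]
  have h2 : ∀ M : Multiset ℕ, (M.map g).sum
      = ((Multiset.sumAddMonoidHom).comp (Multiset.mapAddMonoidHom g)) M := fun _ => rfl
  rw [h2, map_sum]
  refine sum_congr rfl fun s _ => ?_
  simp [Multiset.map_replicate, Multiset.sum_replicate]

theorem sum_maxCrossings (r : ℕ) (m : ℕ → ℕ) (hm : ∀ s : ℕ, s = 0 ∨ r < s → m s = 0) :
    ∑ s ∈ Icc 1 r, m s * ∑ t ∈ Icc 1 r, m t * maxCrossings s t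
      = 2 * ((m 2).choose 2
        + (∑ s ∈ Icc 3 r, 2 * s * (m s).choose 2)
        + 2 * m 2 * (∑ t ∈ Icc 3 r, m t)
        + ∑ s ∈ Icc 3 r, ∑ t ∈ Icc (s + 1) r, 2 * s * m s * m t)
        + ∑ s ∈ Icc 1 r, m s * maxCrossings s s := by
  have hchoose (x : ℕ) : x * x = 2 * x.choose 2 + x := by
    induction x with
    | zero => rfl
    | succ k ih => rw [Nat.choose_succ_succ' k 1, Nat.choose_one_right]; linarith
  have h1 (t : ℕ) : maxCrossings 1 t = 0 := by simp [maxCrossings, chordCount]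
  have h1' (t : ℕ) : maxCrossings t 1 = 0 := by simp [maxCrossings, chordCount]
  have h22 : maxCrossings 2 2 = 1 := rfl
  by_cases hr : 2 ≤ r
  · clear hm
    induction r, hr using Nat.le_induction with
    | base =>
      have : Icc 1 2 = ({1, 2} : Finset ℕ) := rfl
      simp [this, h1, h1', h22, hchoose]
    | succ r hr ih =>
      have hmax : maxCrossings (r + 1) (r + 1) = 2 * (r + 1) := by
        simp only [maxCrossings, chordCount]; split_ifs <;> omega
      have hlt (s : ℕ) (hs : s ≤ r) : maxCrossings s (r + 1) = 2 * chordCount s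
          ∧ maxCrossings (r + 1) s = 2 * chordCount s := by
        simp only [maxCrossings, chordCount]; constructor <;> split_ifs <;> omega
      have hcol : ∑ s ∈ Icc 1 r, m s * (2 * chordCount s)
          = 2 * m 2 + ∑ s ∈ Icc 3 r, 2 * s * m s := by
        clear ih hlt hmax
        induction r, hr using Nat.le_induction with
        | base =>
          have : Icc 1 2 = ({1, 2} : Finset ℕ) := rfl
          simp [this, chordCount, mul_comm]
        | succ r hr ih =>
          rw [sum_Icc_succ_top (by omega), sum_Icc_succ_top (by omega), ih, chordCount,
            if_neg (by omega), if_neg (by omega)]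
          ring
      have hc1 : ∑ s ∈ Icc 1 r, m s * maxCrossings s (r + 1)
          = ∑ s ∈ Icc 1 r, m s * (2 * chordCount s) :=
        sum_congr rfl fun s hs => by rw [(hlt s (mem_Icc.1 hs).2).1]
      have hc2 : ∑ s ∈ Icc 1 r, m s * maxCrossings (r + 1) s
          = ∑ s ∈ Icc 1 r, m s * (2 * chordCount s) :=
        sum_congr rfl fun s hs => by rw [(hlt s (mem_Icc.1 hs).2).2]
      have hinner : ∑ s ∈ Icc 3 (r + 1), ∑ t ∈ Icc (s + 1) (r + 1), 2 * s * m s * m t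
          = ∑ s ∈ Icc 3 r, ∑ t ∈ Icc (s + 1) r, 2 * s * m s * m t
            + (∑ s ∈ Icc 3 r, 2 * s * m s) * m (r + 1) := by
        rw [sum_Icc_succ_top (by omega), Icc_eq_empty_of_lt (Nat.lt_succ_self (r + 1)), sum_empty,
          add_zero, sum_mul, ← sum_add_distrib]
        refine sum_congr rfl fun s hs => ?_
        rw [sum_Icc_succ_top (by have := (mem_Icc.1 hs).2; omega)]
      have hsplit : ∑ s ∈ Icc 1 r, m s * ∑ t ∈ Icc 1 (r + 1), m t * maxCrossings s t
          = ∑ s ∈ Icc 1 r, m s * ∑ t ∈ Icc 1 r, m t * maxCrossings s t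
            + m (r + 1) * ∑ s ∈ Icc 1 r, m s * maxCrossings s (r + 1) := by
        rw [mul_sum, ← sum_add_distrib]
        refine sum_congr rfl fun s hs => ?_
        rw [sum_Icc_succ_top (by omega)]
        ring
      rw [hinner, sum_Icc_succ_top (by omega), hsplit, ih, sum_Icc_succ_top (by omega),
        sum_Icc_succ_top (by omega), sum_Icc_succ_top (by omega), sum_Icc_succ_top (by omega),
        hmax, hc1, hc2, hcol]
      linear_combination (2 * (r + 1)) * hchoose (m (r + 1))
  · have h2 : m 2 = 0 := hm 2 (Or.inr (by omega))
    have h3 : Icc 3 r = ∅ := Icc_eq_empty_of_lt (by omega)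
    have hs : ∀ s ∈ Icc 1 r, s = 1 := fun s hs => by have := mem_Icc.1 hs; omega
    rw [sum_eq_zero, sum_eq_zero (s := Icc 1 r)]
    · simp [h2, h3]
    · intro s h; rw [hs s h, h1, mul_zero]
    · intro s h; simp [hs s h, h1]

/-- Listing the elements of all blocks round-robin gives a set partition with prescribed positive
block sizes in which every block separates all blocks which are not larger. -/
theorem exists_separating (n k : ℕ) (sz : Fin k → ℕ) (hpos : ∀ i, 0 < sz i)
    (hsum : ∑ i, sz i = n) : ∃ π : Finpartition (univ : Finset (Fin n)),
      Multiset.map Finset.card π.parts.val = univ.val.map sz ∧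
      ∀ B ∈ π.parts, ∀ C ∈ π.parts, B ≠ C → #B ≤ #C → Separates C B := by
  classical
  let emb : (Σ i : Fin k, Fin (sz i)) ↪ ℕ ×ₗ Fin k :=
    ⟨fun x => toLex ((x.2 : ℕ), x.1), by
      rintro ⟨i, j⟩ ⟨i', j'⟩ h
      have h' := Prod.mk.inj (toLex.injective h)
      obtain rfl : i = i' := h'.2
      obtain rfl : j = j' := Fin.ext h'.1
      rfl⟩
  let S : Finset (ℕ ×ₗ Fin k) := univ.map emb
  have hS : #S = n := by simp [S, hsum]
  let e : Fin n ≃o S := S.orderIsoOfFin hS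
  have hmem (j : ℕ) (i : Fin k) : toLex (j, i) ∈ S ↔ j < sz i := by
    simp only [S, mem_map, mem_univ, true_and, emb]
    constructor
    · rintro ⟨⟨i', j'⟩, h⟩
      have h' := Prod.mk.inj (toLex.injective h)
      obtain rfl : i' = i := h'.2
      exact h'.1 ▸ j'.2
    · exact fun h => ⟨⟨i, j, h⟩, rfl⟩
  let pt (i : Fin k) (j : Fin (sz i)) : Fin n := e.symm ⟨toLex ((j : ℕ), i), (hmem _ _).2 j.2⟩
  have hlt (i i' : Fin k) (j : Fin (sz i)) (j' : Fin (sz i')) :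
      pt i j < pt i' j' ↔ (j : ℕ) < j' ∨ (j : ℕ) = j' ∧ i < i' := by
    simp only [pt, OrderIso.lt_iff_lt, Subtype.mk_lt_mk, Prod.Lex.toLex_lt_toLex]
  have hinj (i i' : Fin k) (j : Fin (sz i)) (j' : Fin (sz i')) (h : pt i j = pt i' j') :
      i = i' ∧ (j : ℕ) = j' := by
    have h' := Prod.mk.inj (toLex.injective (Subtype.mk.inj (e.symm.injective h)))
    exact ⟨h'.2, h'.1⟩
  have hsurj (x : Fin n) : ∃ i j, pt i j = x := by
    obtain ⟨⟨i, j⟩, -, h⟩ := mem_map.1 (e x).2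
    exact ⟨i, j, e.symm_apply_eq.2 (Subtype.ext h)⟩
  let block (i : Fin k) : Finset (Fin n) := univ.image (pt i)
  have hblock (i : Fin k) (x : Fin n) : x ∈ block i ↔ ∃ j, pt i j = x := by simp [block]
  have hcard (i : Fin k) : #(block i) = sz i := by
    rw [card_image_of_injective _ fun j j' h => Fin.ext (hinj _ _ _ _ h).2]
    simp
  have hbinj : Function.Injective block := by
    intro i i' h
    obtain ⟨j, hj⟩ := (hblock i' _).1 (h ▸ (hblock i _).2 ⟨⟨0, hpos i⟩, rfl⟩)
    exact (hinj _ _ _ _ hj).1.symm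
  refine ⟨Finpartition.ofExistsUnique (univ.map ⟨block, hbinj⟩) (fun _ _ => subset_univ _) ?_ ?_,
    ?_, ?_⟩
  · intro x _
    obtain ⟨i, j, rfl⟩ := hsurj x
    refine ⟨block i, ⟨mem_map_of_mem _ (mem_univ i), (hblock i _).2 ⟨j, rfl⟩⟩, ?_⟩
    rintro _ ⟨hB, hx⟩
    obtain ⟨i', -, rfl⟩ := mem_map.1 hB
    obtain ⟨j', h⟩ := (hblock i' _).1 hx
    rw [(hinj _ _ _ _ h).1]
    rfl
  · intro h
    obtain ⟨i, -, h⟩ := mem_map.1 h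
    have h' := hcard i
    have := hpos i
    simp only [Function.Embedding.coeFn_mk] at h
    rw [h, card_empty] at h'
    omega
  · simp only [Finpartition.ofExistsUnique, map_val, Multiset.map_map]
    exact Multiset.map_congr rfl fun i _ => hcard i
  · intro B hB C hC hne hle
    obtain ⟨i, -, rfl⟩ := mem_map.1 hB
    obtain ⟨i', -, rfl⟩ := mem_map.1 hC
    simp only [Function.Embedding.coeFn_mk, hcard] at hle ⊢
    have hii : i ≠ i' := fun h => hne (by rw [h])
    intro a ha b hb hab
    obtain ⟨j, rfl⟩ := (hblock i a).1 ha
    obtain ⟨j', rfl⟩ := (hblock i b).1 hb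
    have hjj : (j : ℕ) < j' := by
      rcases (hlt _ _ _ _).1 hab with h | h
      · exact h
      · exact absurd h.2 (lt_irrefl _)
    have hin (l : ℕ) (hl : l < sz i') : pt i' ⟨l, hl⟩ ∈ block i' := (hblock i' _).2 ⟨_, rfl⟩
    have hj' := j'.2
    rcases lt_or_gt_of_ne hii with hlt' | hgt
    · refine ⟨⟨_, hin j (by omega), ?_, ?_⟩, _, hin j' (by omega), Or.inr ?_⟩ <;> rw [hlt]
      · exact Or.inr ⟨rfl, hlt'⟩
      · exact Or.inl hjj
      · exact Or.inr ⟨rfl, hlt'⟩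
    · refine ⟨⟨_, hin (j + 1) (by omega), ?_, ?_⟩, _, hin j (by omega), Or.inl ?_⟩ <;> rw [hlt]
      · exact Or.inl (Nat.lt_succ_self _)
      · rcases Nat.lt_or_eq_of_le (Nat.succ_le_of_lt hjj) with h | h
        · exact Or.inl h
        · exact Or.inr ⟨h, hgt⟩
      · exact Or.inr ⟨rfl, hgt⟩

theorem exists_separating_of_multiplicities (n r : ℕ) (m : ℕ → ℕ)
    (hn : n = ∑ s ∈ Icc 1 r, s * m s) : ∃ π : Finpartition (univ : Finset (Fin n)),
      Multiset.map Finset.card π.parts.val = ∑ s ∈ Icc 1 r, Multiset.replicate (m s) s ∧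
      ∀ B ∈ π.parts, ∀ C ∈ π.parts, B ≠ C → #B ≤ #C → Separates C B := by
  let M : Multiset ℕ := ∑ s ∈ Icc 1 r, Multiset.replicate (m s) s
  have hmap : (univ : Finset (Fin M.toList.length)).val.map M.toList.get = M := by
    rw [Fin.univ_val_map, List.ofFn_get, Multiset.coe_toList]
  obtain ⟨π, h, hsep⟩ := exists_separating n M.toList.length M.toList.get (fun i => by
      have hi : M.toList.get i ∈ M := Multiset.mem_toList.1 (List.get_mem _ _)
      obtain ⟨s, hs, h⟩ := Multiset.mem_sum.1 hi
      rw [Multiset.eq_of_mem_replicate h]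
      exact (mem_Icc.1 hs).1) (by
      change (Multiset.map M.toList.get univ.val).sum = n
      rw [hmap, hn, Multiset.sum_sum]
      exact sum_congr rfl fun s _ => by simp [mul_comm])
  exact ⟨π, h.trans hmap, hsep⟩

/-- The maximum of the circular crossing number over set partitions of `[n]` whose block-size
partition is `λ = (1^{m 1} 2^{m 2} ⋯ r^{m r})`. -/
theorem max_crc_blocksizes (n r : ℕ) (m : ℕ → ℕ)
    (hm : ∀ s : ℕ, s = 0 ∨ r < s → m s = 0)
    (hn : n = ∑ s ∈ Finset.Icc 1 r, s * m s) :
    IsGreatest {c : ℕ | ∃ π : Finpartition (univ : Finset (Fin n)),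
        Multiset.map Finset.card π.parts.val
          = ∑ s ∈ Finset.Icc 1 r, Multiset.replicate (m s) s ∧
        crc π = c}
      ((m 2).choose 2
        + (∑ s ∈ Finset.Icc 3 r, 2 * s * (m s).choose 2)
        + 2 * m 2 * (∑ t ∈ Finset.Icc 3 r, m t)
        + ∑ s ∈ Finset.Icc 3 r, ∑ t ∈ Finset.Icc (s + 1) r, 2 * s * m s * m t) := by
  have hsum (π : Finpartition (univ : Finset (Fin n)))
      (h : Multiset.map Finset.card π.parts.val
        = ∑ s ∈ Icc 1 r, Multiset.replicate (m s) s) :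
      ∑ B ∈ π.parts, ∑ C ∈ π.parts, maxCrossings #B #C
        = ∑ s ∈ Icc 1 r, m s * ∑ t ∈ Icc 1 r, m t * maxCrossings s t := by
    rw [← sum_parts_card π h fun s => ∑ t ∈ Icc 1 r, m t * maxCrossings s t]
    exact sum_congr rfl fun B _ => sum_parts_card π h (maxCrossings #B)
  have hdiag (π : Finpartition (univ : Finset (Fin n)))
      (h : Multiset.map Finset.card π.parts.val
        = ∑ s ∈ Icc 1 r, Multiset.replicate (m s) s) :=
    sum_parts_card π h fun s => maxCrossings s s
  have hF := sum_maxCrossings r m hm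
  constructor
  · obtain ⟨π, h, hsep⟩ := exists_separating_of_multiplicities n r m hn
    refine ⟨π, h, ?_⟩
    have h1 := two_mul_crc_add_le π
    have h2 := le_two_mul_crc_add π hsep
    rw [hsum π h, hdiag π h, hF] at h1 h2
    omega
  · rintro _ ⟨π, h, rfl⟩
    have h1 := two_mul_crc_add_le π
    rw [hsum π h, hdiag π h, hF] at h1
    omega
end
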